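/- Equivalence of the Dirac and Dirac–Hestenes equations (odd case n = 2d−1): with t the primitive Hermitian idempotent t = (1/2)(1+e^0)·∏_{μ=1}^{d−1}(1/2)(1+i e^{2μ−1}e^{2μ}) in C⊗Cl(1,2d−1), Q'^(0) the even part of the real subalgebra generated by e^0,e^1,e^2,e^3,e^5,...,e^{2d−1}, I = −e^1e^2, E = e^0: a function φ : ℝ^{1,2d−1} → L(t) solves Σ_{μ=0}^{2d−1} i e^μ(∂_μ + i a_μ)φ = mφ if and only if the unique Ψ : ℝ^{1,2d−1} → Q'^(0) with φ = Ψt solves Σ_{μ∈{0,1,2,3,5,...,2d−1}} e^μ(∂_μΨ + Ψa_μI)E + Σ_{μ∈{3,5,...,2d−3}} (∂_{μ+1}Ψ + Ψa_{μ+1}I)e^μEI + mΨI = 0. -/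

import Mathlib

open CliffordAlgebra TensorProduct

/-- The quadratic form of signature (1, m-1) on `Fin m → ℝ`. -/
noncomputable def Qf (m : ℕ) : QuadraticForm ℝ (Fin m → ℝ) :=
  QuadraticMap.weightedSumSquares ℝ (fun i : Fin m => if (i : ℕ) = 0 then (1 : ℝ) else -1)

/-- The real Clifford algebra Cl(1, m-1). -/
abbrev Cl (m : ℕ) : Type := CliffordAlgebra (Qf m)

/-- The generator e^k of Cl(1,m-1), for k < m (junk value 0 otherwise). -/
noncomputable def eR (m : ℕ) (k : ℕ) : Cl m :=
  if h : k < m then CliffordAlgebra.ι (Qf m) (Pi.single (⟨k, h⟩ : Fin m) 1) else 0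

/-- The complexified Clifford algebra ℂ ⊗ Cl(1,m-1). -/
abbrev CCl (m : ℕ) : Type := ℂ ⊗[ℝ] Cl m

/-- The embedding of the real Clifford algebra into its complexification. -/
noncomputable def inc (m : ℕ) : Cl m →ₐ[ℝ] CCl m := Algebra.TensorProduct.includeRight

/-- The generator e^k inside the complexification. -/
noncomputable def eC (m : ℕ) (k : ℕ) : CCl m := inc m (eR m k)

/-- The list of commuting factors (1/2)(1 + i e^{2j+1} e^{2j+2}), j = 0, …, k-1,
i.e. (1/2)(1 + i e^{2μ-1} e^{2μ}) for μ = 1, …, k. -/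
noncomputable def facs (m k : ℕ) : List (CCl m) :=
  (List.range k).map fun j =>
    (2 : ℂ)⁻¹ • ((1 : CCl m) + Complex.I • (eC m (2 * j + 1) * eC m (2 * j + 2)))

/-- The idempotent t = (1/2)(1 + e^0) ∏_{μ=1}^{k} (1/2)(1 + i e^{2μ-1} e^{2μ}). -/
noncomputable def tIdem (m k : ℕ) : CCl m :=
  ((2 : ℂ)⁻¹ • ((1 : CCl m) + eC m 0)) * (facs m k).prod

/-- Reversion composed with complex conjugation on ℂ ⊗ Cl(1,m-1). -/
noncomputable def starC (m : ℕ) : CCl m →ₗ[ℝ] CCl m :=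
  TensorProduct.map Complex.conjAe.toLinearMap (CliffordAlgebra.reverse (Q := Qf m))

/-- Hermitian conjugation U† = e^0 U* e^0. -/
noncomputable def dagger (m : ℕ) (U : CCl m) : CCl m := eC m 0 * starC m U * eC m 0

/-- The scalar-part (grade-zero) projection of the real Clifford algebra. -/
noncomputable def scalR (m : ℕ) : Cl m →ₗ[ℝ] ℝ :=
  (ExteriorAlgebra.algebraMapInv (R := ℝ) (M := Fin m → ℝ)).toLinearMap ∘ₗ
    (CliffordAlgebra.equivExterior (Qf m)).toLinearMap

/-- The scalar-part projection ⟨·⟩₀ of the complexified Clifford algebra. -/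
noncomputable def scalC (m : ℕ) : CCl m →ₗ[ℝ] ℂ :=
  (TensorProduct.rid ℝ ℂ).toLinearMap ∘ₗ TensorProduct.map LinearMap.id (scalR m)

/-- The inner product (U, V) = ⟨U† V⟩₀. -/
noncomputable def ip (m : ℕ) (U V : CCl m) : ℂ := scalC m (dagger m U * V)

/-- `x = exp a` in the sense of the usual power series ∑ aᵏ/k!, tested against
all real linear functionals. -/
def IsExpOf (m : ℕ) (a x : Cl m) : Prop :=
  ∀ l : Cl m →ₗ[ℝ] ℝ, HasSum (fun k : ℕ => ((k.factorial : ℝ))⁻¹ • l (a ^ k)) (l x)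

/-- The element I = -e¹e² of Cl(1, m-1). -/
noncomputable def Iel (m : ℕ) : Cl m := -(eR m 1 * eR m 2)

/-- The element I = -e¹e² of ℂ ⊗ Cl(1, m-1). -/
noncomputable def IelC (m : ℕ) : CCl m := -(eC m 1 * eC m 2)

/-- The generators e⁰, e¹, e², e³, e⁵, e⁷, …  (e⁰, e², and odd-index generators). -/
def QpGens (m : ℕ) : Set (Cl m) :=
  {u | ∃ k : ℕ, k < m ∧ (k = 0 ∨ k = 2 ∨ Odd k) ∧ u = eR m k}

/-- The even part Q'⁽⁰⁾ of the real subalgebra Q' generated by e⁰, e¹, e², e³, e⁵, …, e^{2d-1}. -/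
noncomputable def Qp0 (m : ℕ) : Subalgebra ℝ (Cl m) :=
  Algebra.adjoin ℝ (QpGens m) ⊓ CliffordAlgebra.even (Qf m)

/-- Pseudo-Euclidean space ℝ^{1,m-1} in coordinates. -/
abbrev Sp (m : ℕ) : Type := Fin m → ℝ

/-- The k-th coordinate direction. -/
noncomputable def dir (m k : ℕ) : Sp m := fun i => if (i : ℕ) = k then 1 else 0

/-- `D` is the partial derivative ∂_k f, in the sense that every real linear functional of f
has the corresponding directional derivative. -/
def PDeriv {m : ℕ} {A : Type} [AddCommGroup A] [Module ℝ A]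
    (f : Sp m → A) (k : ℕ) (D : Sp m → A) : Prop :=
  ∀ (l : A →ₗ[ℝ] ℝ) (x : Sp m),
    HasDerivAt (fun s : ℝ => l (f (x + s • dir m k))) (l (D x)) 0

/-- The multidimensional Dirac--Hestenes equation in Cl(1,2d-1):
∑_{μ∈{0,1,2,3,5,…,2d-1}} e^μ(∂_μΨ + Ψ a_μ I)E
+ ∑_{μ∈{3,5,…,2d-3}} (∂_{μ+1}Ψ + Ψ a_{μ+1} I) e^μ E I + mΨI = 0,
with I = -e¹e², E = e⁰. -/
def DHeq (d : ℕ) (Ψ : Sp (2 * d) → Cl (2 * d)) (DΨ : ℕ → Sp (2 * d) → Cl (2 * d))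
    (a : ℕ → Sp (2 * d) → ℝ) (mass : ℝ) : Prop :=
  ∀ x : Sp (2 * d),
    (∑ k ∈ Finset.range (2 * d), if k = 0 ∨ k = 2 ∨ Odd k then
        eR (2 * d) k * (DΨ k x + a k x • (Ψ x * Iel (2 * d))) * eR (2 * d) 0 else 0)
    + (∑ k ∈ Finset.range (2 * d), if Odd k ∧ 3 ≤ k ∧ k ≤ 2 * d - 3 then
        (DΨ (k + 1) x + a (k + 1) x • (Ψ x * Iel (2 * d))) *
          (eR (2 * d) k * eR (2 * d) 0 * Iel (2 * d)) else 0)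
    + mass • (Ψ x * Iel (2 * d)) = 0

/-- The multidimensional Dirac equation ∑_μ i e^μ(∂_μ + i a_μ)φ = m φ in ℂ ⊗ Cl(1,2d-1). -/
def DiracEq (d : ℕ) (φ : Sp (2 * d) → CCl (2 * d)) (Dφ : ℕ → Sp (2 * d) → CCl (2 * d))
    (a : ℕ → Sp (2 * d) → ℝ) (mass : ℝ) : Prop :=
  ∀ x : Sp (2 * d),
    ∑ k ∈ Finset.range (2 * d),
        Complex.I • (eC (2 * d) k * (Dφ k x + (Complex.I * (a k x : ℂ)) • φ x)) =
      (mass : ℂ) • φ x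


theorem eR_anti (m : ℕ) {i j : ℕ} (h : i ≠ j) : eR m i * eR m j = -(eR m j * eR m i) := by
  unfold eR
  split_ifs with h1 h2 h2
  · apply eq_neg_of_add_eq_zero_left
    rw [CliffordAlgebra.ι_mul_ι_add_swap]
    have : QuadraticMap.polar (Qf m) (Pi.single (⟨i, h1⟩ : Fin m) (1:ℝ))
        (Pi.single (⟨j, h2⟩ : Fin m) (1:ℝ)) = 0 := by
      simp only [QuadraticMap.polar, Qf, QuadraticMap.weightedSumSquares_apply]
      rw [← Finset.sum_sub_distrib, ← Finset.sum_sub_distrib]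
      apply Finset.sum_eq_zero
      intro k _
      by_cases hk : k = ⟨i, h1⟩
      · subst hk
        have : (⟨i, h1⟩ : Fin m) ≠ ⟨j, h2⟩ := by simpa using h
        simp [Pi.single_apply, this]
      · simp [Pi.single_apply, hk]
    rw [this, map_zero]
  all_goals simp

theorem eR_sq (m : ℕ) {i : ℕ} (h : i < m) :
    eR m i * eR m i = if i = 0 then 1 else -1 := by
  unfold eR
  have hq : Qf m (Pi.single (⟨i, h⟩ : Fin m) 1) = if i = 0 then 1 else -1 := by
    simp only [Qf, QuadraticMap.weightedSumSquares_apply]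
    rw [Finset.sum_eq_single (⟨i, h⟩ : Fin m)]
    · split_ifs <;> simp
    · intro b _ hb
      simp [hb]
    · simp
  rw [dif_pos h, CliffordAlgebra.ι_sq_scalar, hq]
  split_ifs
  · rw [map_one]
  · rw [map_neg, map_one]

theorem inv_eR (m i : ℕ) : involute (eR m i) = -eR m i := by
  unfold eR
  split_ifs <;> simp

theorem inv_Iel (m : ℕ) : involute (Iel m) = Iel m := by
  simp [Iel, inv_eR]

/-- sign flip of the k-th coordinate -/
noncomputable def flipL (m k : ℕ) : (Fin m → ℝ) →ₗ[ℝ] (Fin m → ℝ) where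
  toFun x i := if (i : ℕ) = k then - x i else x i
  map_add' x y := by ext i; by_cases h : (i : ℕ) = k <;> simp [h]; ring
  map_smul' c x := by ext i; by_cases h : (i : ℕ) = k <;> simp [h]

noncomputable def flipI (m k : ℕ) : Qf m →qᵢ Qf m where
  toLinearMap := flipL m k
  map_app' x := by
    simp only [Qf, QuadraticMap.weightedSumSquares_apply]
    apply Finset.sum_congr rfl
    intro i _
    by_cases h : (i : ℕ) = k <;> simp [flipL, h]

noncomputable def flipA (m k : ℕ) : Cl m →ₐ[ℝ] Cl m := CliffordAlgebra.map (flipI m k)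

theorem flipA_eR (m k j : ℕ) : flipA m k (eR m j) = if j = k then - eR m j else eR m j := by
  unfold eR flipA
  split_ifs with h1 h2 h2
  · rw [CliffordAlgebra.map_apply_ι, ← map_neg]
    congr 1
    ext i
    change (if (i : ℕ) = k then _ else _) = _
    simp only [Pi.neg_apply]
    split_ifs with h
    · rfl
    · rw [Pi.single_eq_of_ne]; simp
      rintro rfl; exact h h2
  · rw [CliffordAlgebra.map_apply_ι]
    congr 1
    ext i
    change (if (i : ℕ) = k then _ else _) = _
    split_ifs with h
    · rw [Pi.single_eq_of_ne]; simp
      rintro rfl; exact h2 h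
    · rfl
  all_goals simp

theorem flipA_adj (m k : ℕ) (hk : k ≠ 0 ∧ k ≠ 2 ∧ ¬ Odd k) {X : Cl m}
    (hX : X ∈ Algebra.adjoin ℝ (QpGens m)) : flipA m k X = X := by
  induction hX using Algebra.adjoin_induction with
  | mem x hx =>
    obtain ⟨j, _, hj, rfl⟩ := hx
    rw [flipA_eR, if_neg]
    rintro rfl
    tauto
  | algebraMap r => simp
  | add x y _ _ h1 h2 => rw [map_add, h1, h2]
  | mul x y _ _ h1 h2 => rw [map_mul, h1, h2]

theorem comm_adj (m k : ℕ) (hk : k ≠ 0 ∧ k ≠ 2 ∧ ¬ Odd k) {X : Cl m}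
    (hX : X ∈ Algebra.adjoin ℝ (QpGens m)) : eR m k * X = involute X * eR m k := by
  induction hX using Algebra.adjoin_induction with
  | mem x hx =>
    obtain ⟨j, _, hj, rfl⟩ := hx
    rw [inv_eR, eR_anti, neg_mul]
    rintro rfl
    tauto
  | algebraMap r => simp [Algebra.commutes]
  | add x y _ _ h1 h2 => rw [map_add, mul_add, h1, h2, add_mul]
  | mul x y _ _ h1 h2 => rw [map_mul, ← mul_assoc, h1, mul_assoc, h2, mul_assoc]

theorem bb_comm (m : ℕ) {a b c : ℕ} (h1 : a ≠ c) (h2 : b ≠ c) :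
    Commute (eR m a * eR m b) (eR m c) := by
  unfold Commute SemiconjBy
  rw [mul_assoc, eR_anti m h2, mul_neg, ← mul_assoc, eR_anti m h1, neg_mul, neg_neg, mul_assoc]

theorem bb_comm2 (m i j : ℕ) :
    Commute (eR m (2*i+1) * eR m (2*i+2)) (eR m (2*j+1) * eR m (2*j+2)) := by
  by_cases h : i = j
  · subst h; exact Commute.refl _
  · exact Commute.mul_right (bb_comm m (by omega) (by omega)) (bb_comm m (by omega) (by omega))

theorem cneg_mul {m : ℕ} (x y : CCl m) : -x * y = -(x * y) := neg_mul x y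

theorem cmul_neg {m : ℕ} (x y : CCl m) : x * -y = -(x * y) := mul_neg x y

theorem bC_comm (m i j : ℕ) :
    Commute (eC m (2*i+1) * eC m (2*i+2)) (eC m (2*j+1) * eC m (2*j+2)) := by
  have := (bb_comm2 m i j).map (inc m)
  simpa [eC, map_mul] using this

theorem bC_comm0 (m i : ℕ) :
    Commute (eC m (2*i+1) * eC m (2*i+2)) (eC m 0) := by
  have := (bb_comm m (a := 2*i+1) (b := 2*i+2) (c := 0) (by omega) (by omega)).map (inc m)
  simpa [eC, map_mul] using this

theorem tIdem_succ (m k : ℕ) : tIdem m (k+1) = tIdem m k *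
    ((2 : ℂ)⁻¹ • ((1 : CCl m) + Complex.I • (eC m (2 * k + 1) * eC m (2 * k + 2)))) := by
  simp only [tIdem, facs, List.range_succ, List.map_append, List.prod_append, List.map_cons,
    List.map_nil, List.prod_singleton, mul_assoc]

theorem bC_comm_t (m i k : ℕ) :
    Commute (eC m (2*i+1) * eC m (2*i+2)) (tIdem m k) := by
  induction k with
  | zero =>
    simp only [tIdem, facs, List.range_zero, List.map_nil, List.prod_nil, mul_one]
    exact ((Commute.one_right _).add_right (bC_comm0 m i)).smul_right _
  | succ k ih =>
    rw [tIdem_succ]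
    exact ih.mul_right
      (((Commute.one_right _).add_right ((bC_comm m i k).smul_right _)).smul_right _)

theorem eC_sq (m : ℕ) {i : ℕ} (h : i < m) :
    eC m i * eC m i = if i = 0 then 1 else -1 := by
  rw [eC, ← map_mul, eR_sq m h]
  split_ifs <;> simp

theorem eC_anti (m : ℕ) {i j : ℕ} (h : i ≠ j) : eC m i * eC m j = -(eC m j * eC m i) := by
  simp only [eC, ← map_mul, ← map_neg]
  rw [eR_anti m h]

theorem bC_sq (m i : ℕ) (h : 2*i+2 < m) :
    (eC m (2*i+1) * eC m (2*i+2)) * (eC m (2*i+1) * eC m (2*i+2)) = -1 := by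
  have e1 := eC_sq m (i := 2*i+1) (by omega)
  have e2 := eC_sq m (i := 2*i+2) (by omega)
  rw [if_neg (by omega)] at e1 e2
  have e3 := eC_anti m (i := 2*i+2) (j := 2*i+1) (by omega)
  calc _ = eC m (2*i+1) * (eC m (2*i+2) * eC m (2*i+1)) * eC m (2*i+2) := by simp only [mul_assoc]
    _ = -((eC m (2*i+1) * eC m (2*i+1)) * (eC m (2*i+2) * eC m (2*i+2))) := by
      rw [e3, cmul_neg, cneg_mul]; simp only [mul_assoc]
    _ = -1 := by rw [e1, e2, cneg_mul, one_mul, neg_neg]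

theorem bC_t (m i k : ℕ) (hk : 2 * k < m) (hi : i < k) :
    (eC m (2*i+1) * eC m (2*i+2)) * tIdem m k = (-Complex.I) • tIdem m k := by
  induction k with
  | zero => omega
  | succ k ih =>
    rw [tIdem_succ, ← mul_assoc]
    by_cases h : i = k
    · subst h
      rw [(bC_comm_t m i i).eq, mul_assoc, ← mul_smul_comm (-Complex.I) (tIdem m i)]
      congr 1
      have hb := bC_sq m i (by omega)
      generalize eC m (2*i+1) * eC m (2*i+2) = b at hb
      rw [mul_smul_comm, mul_add, mul_smul_comm, hb, smul_comm (-Complex.I)]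
      congr 1
      rw [smul_add, smul_smul]
      simp [add_comm]
    · rw [ih (by omega) (by omega), smul_mul_assoc]

theorem E_t (m k : ℕ) (hm : 0 < m) : eC m 0 * tIdem m k = tIdem m k := by
  rw [tIdem, ← mul_assoc]
  congr 1
  rw [mul_smul_comm, mul_add, eC_sq m hm, if_pos rfl, mul_one, add_comm]

theorem I_t (m k : ℕ) (hk : 2 * k < m) (h : 0 < k) :
    inc m (Iel m) * tIdem m k = Complex.I • tIdem m k := by
  have := bC_t m 0 k hk h
  simp only [Iel, map_neg, map_mul]
  simp only [eC] at this
  simp at this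
  rw [cneg_mul, this, neg_neg]

/-- e^{2i+2} t = i e^{2i+1} t -/
theorem e_even_t (m i k : ℕ) (hk : 2 * k < m) (hi : i < k) :
    eC m (2*i+2) * tIdem m k = Complex.I • (eC m (2*i+1) * tIdem m k) := by
  have h := bC_t m i k hk hi
  have e1 := eC_sq m (i := 2*i+1) (by omega)
  rw [if_neg (by omega)] at e1
  have h2 := congrArg (fun z => eC m (2*i+1) * z) h
  simp only [mul_smul_comm] at h2
  rw [← mul_assoc, ← mul_assoc, e1] at h2
  rw [cneg_mul, one_mul, cneg_mul, neg_smul] at h2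
  exact neg_injective h2

theorem inc_inj (m : ℕ) : Function.Injective (inc m) :=
  Algebra.TensorProduct.includeRight_injective (algebraMap ℝ ℂ).injective

noncomputable def cflip (m : ℕ) (f : Cl m →ₐ[ℝ] Cl m) : CCl m →ₐ[ℂ] CCl m :=
  Algebra.TensorProduct.map (AlgHom.id ℂ ℂ) f

theorem cflip_inc (m : ℕ) (f : Cl m →ₐ[ℝ] Cl m) (X : Cl m) :
    cflip m f (inc m X) = inc m (f X) := by
  simp [cflip, inc]

noncomputable def cconj (m : ℕ) : CCl m →ₐ[ℝ] CCl m :=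
  Algebra.TensorProduct.map Complex.conjAe.toAlgHom (AlgHom.id ℝ (Cl m))

theorem cconj_inc (m : ℕ) (X : Cl m) : cconj m (inc m X) = inc m X := by
  simp [cconj, inc]

theorem cconj_smul (m : ℕ) (c : ℂ) (X : CCl m) :
    cconj m (c • X) = (starRingEnd ℂ c) • cconj m X := by
  induction X using TensorProduct.induction_on with
  | zero => simp
  | tmul a b => simp [cconj, TensorProduct.smul_tmul']
  | add x y h1 h2 => rw [smul_add, map_add, h1, h2, map_add, smul_add]

theorem flip_t (m k j : ℕ) (hj : 2 * k < j) :
    cflip m (flipA m j) (tIdem m k) = tIdem m k := by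
  have key : ∀ i, i ≠ j → cflip m (flipA m j) (eC m i) = eC m i := by
    intro i hi
    rw [eC, cflip_inc, flipA_eR, if_neg hi]
  induction k with
  | zero =>
    simp only [tIdem, facs, List.range_zero, List.map_nil, List.prod_nil, mul_one]
    rw [map_smul, map_add, map_one, key 0 (by omega)]
  | succ k ih =>
    rw [tIdem_succ, map_mul, ih (by omega), map_smul, map_add, map_one, map_smul, map_mul,
      key _ (by omega), key _ (by omega)]

theorem half_cancel {m : ℕ} {A b : CCl m} {c : ℂ}
    (h1 : A * ((2 : ℂ)⁻¹ • (1 + c • b)) = 0) (h2 : A * ((2 : ℂ)⁻¹ • (1 + c • (-b))) = 0) :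
    A = 0 := by
  have : A * ((2 : ℂ)⁻¹ • (1 + c • b)) + A * ((2 : ℂ)⁻¹ • (1 + c • (-b))) = A := by
    rw [← mul_add, ← smul_add, smul_neg]
    have : (1 : CCl m) + c • b + (1 + -(c • b)) = (2:ℂ) • (1 : CCl m) := by
      rw [two_smul]; abel
    rw [this, smul_smul]; simp
  rw [← this, h1, h2, add_zero]

theorem inj_t (m k : ℕ) (hk : 1 ≤ k) {Y : Cl m}
    (hY : Y ∈ Algebra.adjoin ℝ (QpGens m)) (hev : involute Y = Y)
    (h : inc m Y * tIdem m k = 0) : Y = 0 := by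
  induction k, hk using Nat.le_induction with
  | base =>
    have h0 : inc m Y * tIdem m 0 = 0 := by
      rw [tIdem_succ, ← mul_assoc] at h
      refine half_cancel h ?_
      have := congrArg (cconj m) h
      simp only [tIdem, facs, List.range_zero, List.map_nil, List.prod_nil, mul_one] at this ⊢
      have h2 : (starRingEnd ℂ) 2 = 2 := Complex.conj_ofNat 2
      simpa [map_mul, cconj_smul, cconj_inc, eC, h2] using this
    simp only [tIdem, facs, List.range_zero, List.map_nil, List.prod_nil, mul_one] at h0
    apply inc_inj m
    rw [map_zero]
    refine half_cancel (b := eC m 0) (c := 1) (by simpa using h0) ?_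
    have := congrArg (cflip m involute) h0
    rw [map_mul, cflip_inc, hev, map_smul, map_add, map_one, eC, cflip_inc, inv_eR, map_zero] at this
    simpa [eC] using this
  | succ k hk ih =>
    apply ih
    rw [tIdem_succ, ← mul_assoc] at h
    refine half_cancel h ?_
    have := congrArg (cflip m (flipA m (2*k+2))) h
    rw [map_mul, map_mul, cflip_inc, flip_t _ _ _ (by omega), flipA_adj _ _ ⟨by omega, by omega,
      by simp [Nat.odd_iff]⟩ hY, map_smul, map_add, map_one, map_smul, map_mul, eC, eC,
      cflip_inc, cflip_inc, flipA_eR, flipA_eR, if_neg (by omega), if_pos rfl, map_zero, map_neg, cmul_neg] at this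
    simpa [eC] using this

theorem PDeriv_mem {m : ℕ} {A : Type} [AddCommGroup A] [Module ℝ A] (p : Submodule ℝ A)
    {f : Sp m → A} {k : ℕ} {D : Sp m → A} (h : PDeriv f k D) (hf : ∀ x, f x ∈ p) (x : Sp m) :
    D x ∈ p := by
  by_contra hn
  obtain ⟨l, hl, hp⟩ := Submodule.exists_le_ker_of_notMem hn
  have := h l x
  have h0 : (fun s : ℝ => l (f (x + s • dir m k))) = fun _ => 0 := by
    ext s; exact hp (hf _)
  rw [h0] at this
  exact hl (this.unique (hasDerivAt_const _ _))

theorem PDeriv_map {m : ℕ} {A B : Type} [AddCommGroup A] [Module ℝ A] [AddCommGroup B] [Module ℝ B]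
    {f : Sp m → A} {g : Sp m → B} {k : ℕ} {D : Sp m → A} {D' : Sp m → B}
    (T : A →ₗ[ℝ] B) (hfg : ∀ x, g x = T (f x)) (h : PDeriv f k D) (h' : PDeriv g k D')
    (x : Sp m) : D' x = T (D x) := by
  rw [← sub_eq_zero]
  by_contra hn
  apply hn
  rw [← Module.forall_dual_apply_eq_zero_iff ℝ]
  intro l
  have h1 := h (l ∘ₗ T) x
  have h2 := h' l x
  simp only [hfg] at h2
  rw [map_sub, sub_eq_zero]
  exact h2.unique h1

theorem core18 (d m : ℕ) (hm : m = 2 * d) (hd : 2 ≤ d) (mass : ℝ) (a : ℕ → Sp m → ℝ)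
    (φ : Sp m → CCl m)
    (hL : ∀ x, φ x * tIdem m (d - 1) = φ x)
    (Dφ : ℕ → Sp m → CCl m) (hDφ : ∀ k < m, PDeriv φ k (Dφ k))
    (Ψ : Sp m → Cl m) (hmem : ∀ x, Ψ x ∈ Qp0 m)
    (hrel : ∀ x, φ x = inc m (Ψ x) * tIdem m (d - 1))
    (DΨ : ℕ → Sp m → Cl m) (hDΨ : ∀ k < m, PDeriv Ψ k (DΨ k)) :
    (∀ x : Sp m,
    ∑ k ∈ Finset.range m,
        Complex.I • (eC m k * (Dφ k x + (Complex.I * (a k x : ℂ)) • φ x)) =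
      (mass : ℂ) • φ x) ↔
    (∀ x : Sp m,
    (∑ k ∈ Finset.range m, if k = 0 ∨ k = 2 ∨ Odd k then
        eR m k * (DΨ k x + a k x • (Ψ x * Iel m)) * eR m 0 else 0)
    + (∑ k ∈ Finset.range m, if Odd k ∧ 3 ≤ k ∧ k ≤ m - 3 then
        (DΨ (k + 1) x + a (k + 1) x • (Ψ x * Iel m)) *
          (eR m k * eR m 0 * Iel m) else 0)
    + mass • (Ψ x * Iel m) = 0) := by
  set t := tIdem m (d - 1) with ht
  have hI := I_t m (d-1) (by omega) (by omega)
  have hE := E_t m (d-1) (by omega)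
  rw [← ht] at hI hE
  have hD : ∀ k < m, ∀ x, Dφ k x = inc m (DΨ k x) * t := fun k hk x =>
    PDeriv_map ((LinearMap.mulRight ℝ t) ∘ₗ (inc m).toLinearMap) (by intro x; simpa using hrel x)
      (hDΨ k hk) (hDφ k hk) x
  have hDm : ∀ k < m, ∀ x, DΨ k x ∈ Qp0 m := fun k hk x =>
    PDeriv_mem (Subalgebra.toSubmodule (Qp0 m)) (hDΨ k hk) hmem x
  have hgen : ∀ k < m, (k = 0 ∨ k = 2 ∨ Odd k) → eR m k ∈ Algebra.adjoin ℝ (QpGens m) :=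
    fun k hk h => Algebra.subset_adjoin ⟨k, hk, h, rfl⟩
  have hIa : Iel m ∈ Algebra.adjoin ℝ (QpGens m) :=
    neg_mem (mul_mem (hgen 1 (by omega) (by simp)) (hgen 2 (by omega) (by simp)))
  have hinv : ∀ X ∈ Qp0 m, involute X = X := fun X hX =>
    CliffordAlgebra.involute_eq_of_mem_even hX.2
  refine forall_congr' fun x => ?_
  set X : ℕ → Cl m := fun k => DΨ k x + a k x • (Ψ x * Iel m) with hXdef
  have hXa : ∀ k < m, X k ∈ Algebra.adjoin ℝ (QpGens m) := fun k hk =>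
    add_mem (hDm k hk x).1 (Subalgebra.smul_mem _ (mul_mem (hmem x).1 hIa) _)
  have hXi : ∀ k < m, involute (X k) = X k := fun k hk => by
    simp only [hXdef, map_add, map_smul, map_mul, inv_Iel, hinv _ (hDm k hk x), hinv _ (hmem x)]
  have hXt : ∀ k < m, Dφ k x + (Complex.I * (a k x : ℂ)) • φ x = inc m (X k) * t := by
    intro k hk
    simp only [hXdef, map_add, map_smul, map_mul, add_mul, smul_mul_assoc]
    rw [hD k hk, hrel, mul_assoc (inc m (Ψ x)), hI, mul_smul_comm, mul_comm Complex.I, mul_smul]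
    rfl
  have hL1 : ∑ k ∈ Finset.range m,
      Complex.I • (eC m k * (Dφ k x + (Complex.I * (a k x : ℂ)) • φ x)) =
      Complex.I • ∑ k ∈ Finset.range m, eC m k * (inc m (X k) * t) := by
    rw [Finset.smul_sum]
    refine Finset.sum_congr rfl fun k hk => ?_
    rw [hXt k (Finset.mem_range.1 hk)]
  rw [hL1]
  set S1 : Cl m := ∑ k ∈ Finset.range m, if k = 0 ∨ k = 2 ∨ Odd k then
        eR m k * X k * eR m 0 else 0 with hS1
  set S2 : Cl m := ∑ k ∈ Finset.range m, if Odd k ∧ 3 ≤ k ∧ k ≤ m - 3 then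
        X (k + 1) * (eR m k * eR m 0 * Iel m) else 0 with hS2
  change _ ↔ S1 + S2 + mass • (Ψ x * Iel m) = 0
  have h0 : (0:ℕ) < m := by omega
  have hYa : S1 + S2 + mass • (Ψ x * Iel m) ∈ Algebra.adjoin ℝ (QpGens m) := by
    refine add_mem (add_mem (sum_mem fun k hk => ?_) (sum_mem fun k hk => ?_))
      (Subalgebra.smul_mem _ (mul_mem (hmem x).1 hIa) _)
    · have hk := Finset.mem_range.1 hk
      split_ifs with h
      · exact mul_mem (mul_mem (hgen k hk h) (hXa k hk)) (hgen 0 h0 (by simp))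
      · exact zero_mem _
    · have hk := Finset.mem_range.1 hk
      split_ifs with h
      · exact mul_mem (hXa _ (by omega)) (mul_mem (mul_mem (hgen k hk (by tauto))
          (hgen 0 h0 (by simp))) hIa)
      · exact zero_mem _
  have hYi : involute (S1 + S2 + mass • (Ψ x * Iel m)) = S1 + S2 + mass • (Ψ x * Iel m) := by
    rw [map_add, map_add, map_smul, map_mul, inv_Iel, hinv _ (hmem x), hS1, hS2, map_sum, map_sum]
    congr 2
    · refine Finset.sum_congr rfl fun k hk => ?_
      have hk := Finset.mem_range.1 hk
      split_ifs with h
      · simp [inv_eR, hXi k hk]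
      · simp
    · refine Finset.sum_congr rfl fun k hk => ?_
      split_ifs with h
      · simp [inv_eR, inv_Iel, hXi (k+1) (by omega)]
      · simp
  have hYt : inc m (S1 + S2 + mass • (Ψ x * Iel m)) * t =
      (∑ k ∈ Finset.range m, eC m k * (inc m (X k) * t)) + Complex.I • ((mass : ℂ) • φ x) := by
    rw [map_add, map_add, add_mul, add_mul]
    congr 1
    · have e1 : inc m S1 * t = ∑ k ∈ Finset.range m, if k = 0 ∨ k = 2 ∨ Odd k then
          eC m k * (inc m (X k) * t) else 0 := by
        rw [hS1, map_sum, Finset.sum_mul]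
        refine Finset.sum_congr rfl fun k hk => ?_
        split_ifs with h
        · rw [map_mul, map_mul, mul_assoc]
          change _ * (eC m 0 * t) = _
          rw [hE, mul_assoc]; rfl
        · simp
      have e2 : inc m S2 * t = ∑ k ∈ Finset.range m, if k = 0 ∨ k = 2 ∨ Odd k then 0 else
          eC m k * (inc m (X k) * t) := by
        have hm1 : Finset.range m = Finset.range ((m - 1) + 1) := by congr 1; omega
        rw [hS2, map_sum, Finset.sum_mul, hm1, Finset.sum_range_succ, Finset.sum_range_succ',
          if_neg (by omega), if_pos (Or.inl rfl), map_zero, zero_mul, add_zero, add_zero]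
        refine Finset.sum_congr rfl fun k hk => ?_
        have hk := Finset.mem_range.1 hk
        have hiff : (Odd k ∧ 3 ≤ k ∧ k ≤ m - 3) ↔ ¬ (k + 1 = 0 ∨ k + 1 = 2 ∨ Odd (k+1)) := by
          simp only [Nat.odd_iff]; omega
        by_cases h : Odd k ∧ 3 ≤ k ∧ k ≤ m - 3
        · rw [if_pos h, if_neg (hiff.1 h)]
          obtain ⟨i, rfl⟩ := h.1
          have hc := comm_adj m (2*i+1+1) ⟨by omega, by omega, by simp [Nat.odd_iff]; omega⟩
            (hXa (2*i+1+1) (by omega))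
          rw [hXi _ (by omega)] at hc
          have hc' := congrArg (inc m) hc
          rw [map_mul, map_mul] at hc'
          rw [eC, ← mul_assoc (inc m (eR m (2*i+1+1))), hc', map_mul, mul_assoc (inc m (X (2*i+1+1))),
            mul_assoc (inc m (X (2*i+1+1)))]
          congr 1
          have := e_even_t m i (d-1) (by omega) (by omega)
          rw [← ht] at this
          change _ = eC m (2*i+2) * t
          rw [this, map_mul, map_mul, mul_assoc, hI, mul_smul_comm, mul_assoc]
          change _ • (_ * (eC m 0 * t)) = _
          rw [hE]; rfl
        · rw [if_neg h, if_pos (by tauto)]; simp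
      rw [e1, e2, ← Finset.sum_add_distrib]
      refine Finset.sum_congr rfl fun k hk => ?_
      split_ifs <;> simp
    · rw [map_smul, map_mul, smul_mul_assoc, mul_assoc, hI, mul_smul_comm, hrel, smul_comm]
      rfl
  have hfin : ∀ S F : CCl m, Complex.I • S = F ↔ S + Complex.I • F = 0 := by
    intro S F
    constructor
    · rintro rfl
      rw [smul_smul]; simp
    · intro h
      rw [eq_neg_of_add_eq_zero_left h, smul_neg, smul_smul]; simp
  rw [hfin, ← hYt]
  constructor
  · exact fun h => inj_t m (d-1) (by omega) hYa hYi h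
  · intro h
    rw [h]; simp

theorem stmt18 (d : ℕ) (hd : 2 ≤ d) (mass : ℝ) (a : ℕ → Sp (2 * d) → ℝ)
    (φ : Sp (2 * d) → CCl (2 * d))
    (hL : ∀ x, φ x * tIdem (2 * d) (d - 1) = φ x)
    (Dφ : ℕ → Sp (2 * d) → CCl (2 * d)) (hDφ : ∀ k < 2 * d, PDeriv φ k (Dφ k))
    (Ψ : Sp (2 * d) → Cl (2 * d)) (hmem : ∀ x, Ψ x ∈ Qp0 (2 * d))
    (hrel : ∀ x, φ x = inc (2 * d) (Ψ x) * tIdem (2 * d) (d - 1))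
    (DΨ : ℕ → Sp (2 * d) → Cl (2 * d)) (hDΨ : ∀ k < 2 * d, PDeriv Ψ k (DΨ k)) :
    DiracEq d φ Dφ a mass ↔ DHeq d Ψ DΨ a mass := by
  exact core18 d (2 * d) rfl hd mass a φ hL Dφ hDφ Ψ hmem hrel DΨ hDΨ
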